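/- (Theorem, action-quantized AIS: value approximation.) Suppose {σ̂_t, q, P̂_t, r̂_t}_{t=1}^T is an (ε_t, δ_t)-action-quantized AIS generator with surjective quantizer q : 𝒜 → 𝒜̂. Define V̂_{T+1} ≡ 0 and, for t = T,…,1, Q̂_t(ẑ, â) = r̂_t(ẑ, â) + ∫ V̂_{t+1}(ẑ') P̂_t(dẑ' | ẑ, â) for â ∈ 𝒜̂ and V̂_t(ẑ) = max_{â ∈ 𝒜̂} Q̂_t(ẑ, â). Then for every t, h_t, and a_t ∈ 𝒜: |Q_t(h_t, a_t) − Q̂_t(σ̂_t(h_t), q(a_t))| ≤ α_t and |V_t(h_t) − V̂_t(σ̂_t(h_t))| ≤ α_t, where α_{T+1} = 0 and α_t = ε_t + ρ_𝔉(V̂_{t+1}) δ_t + α_{t+1}. -/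

import Mathlib

open MeasureTheory ProbabilityTheory

universe u

/-- The integral probability metric (IPM) associated with a function class `F`. -/
noncomputable def ipm {X : Type u} [MeasurableSpace X] (F : Set (X → ℝ))
    (μ ν : Measure X) : ℝ :=
  sSup ((fun f => |∫ x, f x ∂μ - ∫ x, f x ∂ν|) '' F)

/-- The Minkowski functional (gauge) of a function `f` with respect to the class `F`. -/
noncomputable def mink {X : Type u} (F : Set (X → ℝ)) (f : X → ℝ) : ℝ :=
  sInf {c : ℝ | 0 < c ∧ (fun x => c⁻¹ * f x) ∈ F}

/-- `F` is a class of uniformly bounded measurable real-valued functions. -/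
def UnifBddMeas {X : Type u} [MeasurableSpace X] (F : Set (X → ℝ)) : Prop :=
  (∀ f ∈ F, Measurable f) ∧ ∃ C : ℝ, ∀ f ∈ F, ∀ x, |f x| ≤ C

/-- History spaces of a partially observed system: `ℋ_{t+1} = ℋ_t × 𝒴 × 𝒜`. -/
def Hist (H0 Y A : Type u) : ℕ → Type u
  | 0 => H0
  | (t+1) => Hist H0 Y A t × Y × A

instance Hist.instMeasurableSpace {H0 Y A : Type u} [MeasurableSpace H0]
    [MeasurableSpace Y] [MeasurableSpace A] :
    ∀ t, MeasurableSpace (Hist H0 Y A t)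
  | 0 => inferInstanceAs (MeasurableSpace H0)
  | (t+1) =>
    letI := Hist.instMeasurableSpace (H0 := H0) (Y := Y) (A := A) t
    inferInstanceAs (MeasurableSpace (Hist H0 Y A t × Y × A))

theorem UnifBddMeas.bddAbove_image {X : Type u} [MeasurableSpace X] {F : Set (X → ℝ)}
    (hF : UnifBddMeas F) (μ ν : Measure X) [IsProbabilityMeasure μ] [IsProbabilityMeasure ν] :
    BddAbove ((fun f => |∫ x, f x ∂μ - ∫ x, f x ∂ν|) '' F) := by
  obtain ⟨-, C, hC⟩ := hF
  have integral_bound (ρ : Measure X) [IsProbabilityMeasure ρ] (f : X → ℝ) (hf : f ∈ F) :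
      |∫ x, f x ∂ρ| ≤ C := by
    simpa using norm_integral_le_of_norm_le_const (μ := ρ) (f := f) (C := C)
      (Filter.Eventually.of_forall fun x => hC f hf x)
  refine ⟨C + C, ?_⟩
  rintro _ ⟨f, hf, rfl⟩
  exact (abs_sub _ _).trans (add_le_add (integral_bound μ f hf) (integral_bound ν f hf))

theorem ipm_nonneg {X : Type u} [MeasurableSpace X] (F : Set (X → ℝ)) (μ ν : Measure X) :
    0 ≤ ipm F μ ν := by
  refine Real.sSup_nonneg ?_
  rintro _ ⟨f, -, rfl⟩
  exact abs_nonneg _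

/-- The defining inequality of the gauge: differences of integrals are controlled by `ρ_F(f)`
times the integral probability metric. -/
theorem abs_integral_sub_integral_le_mink_mul {X : Type u} [MeasurableSpace X]
    {F : Set (X → ℝ)} (hF : UnifBddMeas F) (μ ν : Measure X) [IsProbabilityMeasure μ]
    [IsProbabilityMeasure ν] {f : X → ℝ} {δ : ℝ} (hδ : ipm F μ ν ≤ δ)
    (hf : {c : ℝ | 0 < c ∧ (fun x => c⁻¹ * f x) ∈ F}.Nonempty) :
    |∫ x, f x ∂μ - ∫ x, f x ∂ν| ≤ mink F f * δ := by
  have le_mul (c : ℝ) (hc : 0 < c) (hcF : (fun x => c⁻¹ * f x) ∈ F) :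
      |∫ x, f x ∂μ - ∫ x, f x ∂ν| ≤ c * δ := by
    have h := (le_csSup (hF.bddAbove_image μ ν) (Set.mem_image_of_mem _ hcF)).trans hδ
    simp only [integral_const_mul, ← mul_sub, abs_mul, abs_of_pos (inv_pos.2 hc)] at h
    rwa [inv_mul_le_iff₀ hc] at h
  rcases ((ipm_nonneg F μ ν).trans hδ).eq_or_lt with h0 | hpos
  · obtain ⟨c, hc, hcF⟩ := hf
    simpa [← h0] using le_mul c hc hcF
  · rw [← div_le_iff₀ hpos]
    refine le_csInf hf ?_
    rintro c ⟨hc, hcF⟩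
    exact (div_le_iff₀ hpos).2 (le_mul c hc hcF)

theorem UnifBddMeas.measurable_bounded_of_gauge {X : Type u} [MeasurableSpace X]
    {F : Set (X → ℝ)} (hF : UnifBddMeas F) {f : X → ℝ}
    (hf : {c : ℝ | 0 < c ∧ (fun x => c⁻¹ * f x) ∈ F}.Nonempty) :
    Measurable f ∧ ∃ C : ℝ, ∀ x, |f x| ≤ C := by
  obtain ⟨c, hc, hcF⟩ := hf
  obtain ⟨hm, C, hC⟩ := hF
  have hfc : f = fun x => c * (c⁻¹ * f x) := by
    funext x
    rw [mul_inv_cancel_left₀ hc.ne']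
  refine ⟨hfc ▸ (hm _ hcF).const_mul c, c * C, fun x => ?_⟩
  rw [congrFun hfc x, abs_mul, abs_of_pos hc]
  exact mul_le_mul_of_nonneg_left (hC _ hcF x) hc.le

theorem abs_ciSup_sub_ciSup_le {ι : Type*} [Finite ι] [Nonempty ι] {f g : ι → ℝ} {c : ℝ}
    (h : ∀ i, |f i - g i| ≤ c) : |(⨆ i, f i) - ⨆ i, g i| ≤ c := by
  have hfb := (Set.finite_range f).bddAbove
  have hgb := (Set.finite_range g).bddAbove
  have hfg : ⨆ i, f i ≤ (⨆ i, g i) + c := ciSup_le fun i => by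
    linarith [le_ciSup hgb i, (abs_le.1 (h i)).2]
  have hgf : ⨆ i, g i ≤ (⨆ i, f i) + c := ciSup_le fun i => by
    linarith [le_ciSup hfb i, (abs_le.1 (h i)).1]
  exact abs_le.2 ⟨by linarith, by linarith⟩

theorem Hist.measurable_snoc {H0 Y A : Type u} [MeasurableSpace H0] [MeasurableSpace Y]
    [MeasurableSpace A] (t : ℕ) (a : A) :
    Measurable (fun p : Hist H0 Y A t × Y => ((p.1, p.2, a) : Hist H0 Y A (t+1))) :=
  measurable_fst.prodMk (measurable_snd.prodMk measurable_const)

/-- A Bellman backup of a measurable function of the history is measurable, for any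
σ-algebra on the finite action set. -/
theorem measurable_bellman {H0 Y A : Type u} [MeasurableSpace H0] [MeasurableSpace Y]
    [MeasurableSpace A] [Finite A] (t : ℕ)
    (κ : Kernel (Hist H0 Y A t × A) Y) [IsMarkovKernel κ] {r : Hist H0 Y A t × A → ℝ}
    (hr : Measurable r) {V : Hist H0 Y A (t+1) → ℝ} (hV : Measurable V) :
    Measurable fun h : Hist H0 Y A t =>
      ⨆ a : A, (r (h, a) + ∫ y, V ((h, y, a) : Hist H0 Y A (t+1)) ∂(κ (h, a))) := by
  refine Measurable.iSup fun a => (hr.comp measurable_prodMk_right).add ?_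
  have hVa : StronglyMeasurable (Function.uncurry fun (h : Hist H0 Y A t) (y : Y) =>
      V ((h, y, a) : Hist H0 Y A (t+1))) :=
    (hV.comp (Hist.measurable_snoc t a)).stronglyMeasurable
  exact (hVa.integral_kernel_prod_right
    (κ := κ.comap (fun h => (h, a)) measurable_prodMk_right)).measurable

/-- **Theorem: action-quantized AIS, value approximation.**
Suppose `{σ, q, Phat, rhat}` is an `(ε_t, δ_t)`-action-quantized AIS generator, where
`q : 𝒜 → 𝒜̂ ⊆ 𝒜` is a surjective action quantizer, satisfying (AQ1) and (AQ2).  Define the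
AIS value functions by the backward recursion with maximization over `𝒜̂`.  Then for every
`t, h_t, a_t`: `|Q_t(h_t,a_t) − Q̂_t(σ̂_t(h_t), q(a_t))| ≤ α_t` and
`|V_t(h_t) − V̂_t(σ̂_t(h_t))| ≤ α_t`, where `α_{T+1} = 0` and
`α_t = ε_t + ρ_𝔉(V̂_{t+1}) δ_t + α_{t+1}`. -/
theorem action_quantized_ais_value_approximation
    {H0 Y A : Type u} [MeasurableSpace H0] [MeasurableSpace Y] [MeasurableSpace A]
    [Fintype A] [Nonempty A]
    (T : ℕ)
    (obs : ∀ t, Kernel (Hist H0 Y A t × A) Y) [∀ t, IsMarkovKernel (obs t)]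
    (r : ∀ t, Hist H0 Y A t × A → ℝ)
    (hrm : ∀ t, Measurable (r t)) (hrb : ∃ C : ℝ, ∀ t p, |r t p| ≤ C)
    -- the quantized action set `𝒜̂ ⊆ 𝒜` and surjective quantizer `q : 𝒜 → 𝒜̂`
    (Ahat : Set A) (hAhat : Ahat.Nonempty)
    (q : A → A) (hq : ∀ a, q a ∈ Ahat) (hqsurj : ∀ a ∈ Ahat, ∃ a', q a' = a)
    -- the action-quantized AIS generator
    {Z : ℕ → Type u} [∀ t, MeasurableSpace (Z t)]
    (σ : ∀ t, Hist H0 Y A t → Z t) (hσ : ∀ t, Measurable (σ t))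
    (Phat : ∀ t, Kernel (Z t × A) (Z (t+1))) [∀ t, IsMarkovKernel (Phat t)]
    (rhat : ∀ t, Z t × A → ℝ)
    (hrhatm : ∀ t, Measurable (rhat t)) (hrhatb : ∃ C : ℝ, ∀ t p, |rhat t p| ≤ C)
    (F : ∀ t, Set (Z t → ℝ)) (hF : ∀ t, UnifBddMeas (F t))
    (ε δ : ℕ → ℝ)
    (hAQ1 : ∀ t ≤ T, ∀ (h : Hist H0 Y A t) (a : A),
      |r t (h, a) - rhat t (σ t h, q a)| ≤ ε t)
    (hAQ2 : ∀ t ≤ T, ∀ (h : Hist H0 Y A t) (a : A),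
      ipm (F (t+1))
        (((obs t) (h, a)).map (fun y => σ (t+1) ((h, y, a) : Hist H0 Y A (t+1))))
        ((Phat t) (σ t h, q a)) ≤ δ t)
    -- the optimal value functions
    (Q : ∀ t, Hist H0 Y A t → A → ℝ) (V : ∀ t, Hist H0 Y A t → ℝ)
    (hVT : ∀ h, V (T+1) h = 0)
    (hQ : ∀ t ≤ T, ∀ (h : Hist H0 Y A t) (a : A),
      Q t h a = r t (h, a) +
        ∫ y, V (t+1) ((h, y, a) : Hist H0 Y A (t+1)) ∂((obs t) (h, a)))
    (hV : ∀ t ≤ T, ∀ h : Hist H0 Y A t, V t h = ⨆ a : A, Q t h a)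
    -- the AIS value functions (with actions in `𝒜̂`)
    (Qhat : ∀ t, Z t → A → ℝ) (Vhat : ∀ t, Z t → ℝ)
    (hVhatT : ∀ z, Vhat (T+1) z = 0)
    (hQhat : ∀ t ≤ T, ∀ (z : Z t), ∀ a ∈ Ahat,
      Qhat t z a = rhat t (z, a) + ∫ z', Vhat (t+1) z' ∂((Phat t) (z, a)))
    (hVhat : ∀ t ≤ T, ∀ z : Z t, Vhat t z = ⨆ a : Ahat, Qhat t z a)
    -- finiteness of the Minkowski functionals ρ_𝔉(V̂_{t+1})
    (hmink : ∀ t ≤ T,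
      {c : ℝ | 0 < c ∧ (fun z => c⁻¹ * Vhat (t+1) z) ∈ F (t+1)}.Nonempty)
    -- the error recursion
    (α : ℕ → ℝ) (hαT : α (T+1) = 0)
    (hα : ∀ t ≤ T, α t = ε t + mink (F (t+1)) (Vhat (t+1)) * δ t + α (t+1)) :
    ∀ t ≤ T, ∀ (h : Hist H0 Y A t) (a : A),
      |Q t h a - Qhat t (σ t h) (q a)| ≤ α t ∧ |V t h - Vhat t (σ t h)| ≤ α t := by
  have measurable_V : ∀ t (_ : t ≤ T + 1), Measurable (V t) := by
    intro t ht
    induction ht using Nat.decreasingInduction with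
    | self => exact (funext hVT : V (T+1) = fun _ => 0) ▸ measurable_const
    | of_succ t ht ih =>
      have htT : t ≤ T := Nat.lt_succ_iff.1 ht
      have hVt : V t = fun h => ⨆ a : A, (r t (h, a) +
          ∫ y, V (t+1) ((h, y, a) : Hist H0 Y A (t+1)) ∂((obs t) (h, a))) := by
        funext h
        simp only [hV t htT, hQ t htT]
      exact hVt ▸ measurable_bellman t (obs t) (hrm t) ih
  have Q_bound : ∀ t ≤ T,
      (∀ h, |V (t+1) h - Vhat (t+1) (σ (t+1) h)| ≤ α (t+1)) →
      ∀ h a, |Q t h a - Qhat t (σ t h) (q a)| ≤ α t := by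
    intro t ht hVt h a
    have hsnoc : Measurable fun y : Y => ((h, y, a) : Hist H0 Y A (t+1)) :=
      (Hist.measurable_snoc t a).comp measurable_prodMk_left
    have hσy : Measurable fun y : Y => σ (t+1) ((h, y, a) : Hist H0 Y A (t+1)) :=
      (hσ (t+1)).comp hsnoc
    obtain ⟨hVhm, C, hC⟩ := (hF (t+1)).measurable_bounded_of_gauge (hmink t ht)
    have : IsProbabilityMeasure (((obs t) (h, a)).map
        fun y => σ (t+1) ((h, y, a) : Hist H0 Y A (t+1))) :=
      Measure.isProbabilityMeasure_map hσy.aemeasurable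
    have hmodel := abs_integral_sub_integral_le_mink_mul (hF (t+1)) _ _
      (hAQ2 t ht h a) (hmink t ht)
    rw [integral_map hσy.aemeasurable hVhm.aestronglyMeasurable] at hmodel
    have hVhat_int : Integrable
        (fun y => Vhat (t+1) (σ (t+1) ((h, y, a) : Hist H0 Y A (t+1)))) ((obs t) (h, a)) :=
      Integrable.of_bound (hVhm.comp hσy).aestronglyMeasurable C
        (Filter.Eventually.of_forall fun y => hC _)
    have hdiff_int : Integrable (fun y => V (t+1) ((h, y, a) : Hist H0 Y A (t+1)) -
        Vhat (t+1) (σ (t+1) ((h, y, a) : Hist H0 Y A (t+1)))) ((obs t) (h, a)) :=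
      Integrable.of_bound (((measurable_V (t+1) (by lia)).comp hsnoc).sub
        (hVhm.comp hσy)).aestronglyMeasurable (α (t+1))
        (Filter.Eventually.of_forall fun y => hVt _)
    have hV_int : Integrable (fun y => V (t+1) ((h, y, a) : Hist H0 Y A (t+1)))
        ((obs t) (h, a)) := by
      refine (hdiff_int.add hVhat_int).congr (Filter.Eventually.of_forall fun y => ?_)
      simp
    have hvalue := norm_integral_le_of_norm_le_const (μ := (obs t) (h, a))
      (f := fun y => V (t+1) ((h, y, a) : Hist H0 Y A (t+1)) -
        Vhat (t+1) (σ (t+1) ((h, y, a) : Hist H0 Y A (t+1))))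
      (Filter.Eventually.of_forall fun y => hVt _)
    rw [integral_sub hV_int hVhat_int] at hvalue
    simp only [Real.norm_eq_abs, probReal_univ, mul_one] at hvalue
    have hreward := hAQ1 t ht h a
    rw [hQ t ht, hQhat t ht _ _ (hq a), hα t ht]
    rw [abs_le] at *
    constructor <;> linarith
  have V_bound_of_Q_bound : ∀ t ≤ T,
      (∀ h a, |Q t h a - Qhat t (σ t h) (q a)| ≤ α t) →
      ∀ h, |V t h - Vhat t (σ t h)| ≤ α t := by
    intro t ht hQt h
    have hsurj : Function.Surjective fun a => (⟨q a, hq a⟩ : Ahat) := fun b =>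
      (hqsurj b b.2).imp fun _ h => Subtype.ext h
    rw [hV t ht, hVhat t ht, ← hsurj.iSup_comp]
    exact abs_ciSup_sub_ciSup_le (hQt h)
  have V_bound : ∀ t (_ : t ≤ T + 1), ∀ h, |V t h - Vhat t (σ t h)| ≤ α t := by
    intro t ht
    induction ht using Nat.decreasingInduction with
    | self => simp [hVT, hVhatT, hαT]
    | of_succ t ht ih =>
      have htT : t ≤ T := Nat.lt_succ_iff.1 ht
      exact V_bound_of_Q_bound t htT (Q_bound t htT ih)
  exact fun t ht h a => ⟨Q_bound t ht (V_bound (t+1) (by lia)) h a, V_bound t (by lia) h⟩
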